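/- Let k be a field of characteristic zero and let Q₁,Q₂,Q₃,Q₄ ∈ k[x₁,x₂,x₃,x₄] be homogeneous quadratic forms that are linearly dependent in the space of quadratic forms (in particular, this holds if the pencils span{Q₁,Q₂} and span{Q₃,Q₄} share a nonzero quadric, or if all four lie in a common 3-dimensional space of quadrics). Then the Jacobian brackets {·,·}_{Q₁,Q₂} and {·,·}_{Q₃,Q₄} are compatible: their mixed Jacobiator J(f,g,h) vanishes for all f,g,h ∈ k[x₁,…,x₄]. -/

import Mathlib

open MvPolynomial

noncomputable section

/-- The Jacobian bracket `{f,g}_{P,Q}`: the determinant of the 4×4 matrix whose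
columns are the gradients ∇f, ∇g, ∇P, ∇Q. -/
def jacBracket {k : Type*} [Field k] (P Q f g : MvPolynomial (Fin 4) k) :
    MvPolynomial (Fin 4) k :=
  Matrix.det (Matrix.of fun i j => pderiv i (![f, g, P, Q] j))

/-- Mixed Jacobiator of two brackets. -/
def mixedJacobiator {k : Type*} [Field k]
    (b₁ b₂ : MvPolynomial (Fin 4) k → MvPolynomial (Fin 4) k → MvPolynomial (Fin 4) k)
    (f g h : MvPolynomial (Fin 4) k) : MvPolynomial (Fin 4) k :=
  b₂ (b₁ f g) h + b₂ (b₁ g h) f + b₂ (b₁ h f) g +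
    b₁ (b₂ f g) h + b₁ (b₂ g h) f + b₁ (b₂ h f) g

/-- The gradient of `Q` evaluated at `v`. -/
def gradEval {k : Type*} [Field k] (Q : MvPolynomial (Fin 4) k) (v : Fin 4 → k) :
    Fin 4 → k :=
  fun i => eval v (pderiv i Q)

/-- The pair of quadrics `(Q₁, Q₂)` cuts out a normal elliptic curve in `P³`:
at every nonzero common zero, the gradients are linearly independent. -/
def CutsOutEllipticCurve {k : Type*} [Field k] (Q₁ Q₂ : MvPolynomial (Fin 4) k) : Prop :=
  ∀ v : Fin 4 → k, v ≠ 0 → eval v Q₁ = 0 → eval v Q₂ = 0 →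
    LinearIndependent k ![gradEval Q₁ v, gradEval Q₂ v]

theorem MvPolynomial.pderiv_pderiv_comm {R σ : Type*} [CommRing R] (i j : σ)
    (f : MvPolynomial σ R) : pderiv i (pderiv j f) = pderiv j (pderiv i f) := by
  classical
  have h : ⁅pderiv (R := R) i, pderiv (R := R) j⁆ = 0 := by
    refine derivation_ext fun l => ?_
    rw [Derivation.commutator_apply, pderiv_X, pderiv_X]
    simp only [Pi.single_apply, apply_ite (pderiv _), map_zero, pderiv_one, ite_self, sub_self,
      Derivation.zero_apply]
  have hf := DFunLike.congr_fun h f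
  rwa [Derivation.commutator_apply, Derivation.zero_apply, sub_eq_zero] at hf

section Bracket

variable {k : Type*} [Field k]

/-- Laplace expansion of the Jacobian bracket. -/
theorem jacBracket_eq (P Q f g : MvPolynomial (Fin 4) k) :
    jacBracket P Q f g =
      (pderiv 0 f * pderiv 1 g - pderiv 1 f * pderiv 0 g) *
        (pderiv 2 P * pderiv 3 Q - pderiv 3 P * pderiv 2 Q) -
      (pderiv 0 f * pderiv 2 g - pderiv 2 f * pderiv 0 g) *
        (pderiv 1 P * pderiv 3 Q - pderiv 3 P * pderiv 1 Q) +
      (pderiv 0 f * pderiv 3 g - pderiv 3 f * pderiv 0 g) *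
        (pderiv 1 P * pderiv 2 Q - pderiv 2 P * pderiv 1 Q) +
      (pderiv 1 f * pderiv 2 g - pderiv 2 f * pderiv 1 g) *
        (pderiv 0 P * pderiv 3 Q - pderiv 3 P * pderiv 0 Q) -
      (pderiv 1 f * pderiv 3 g - pderiv 3 f * pderiv 1 g) *
        (pderiv 0 P * pderiv 2 Q - pderiv 2 P * pderiv 0 Q) +
      (pderiv 2 f * pderiv 3 g - pderiv 3 f * pderiv 2 g) *
        (pderiv 0 P * pderiv 1 Q - pderiv 1 P * pderiv 0 Q) := by
  simp [jacBracket, Matrix.det_succ_row_zero, Fin.sum_univ_succ, Fin.succAbove]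
  ring

theorem jacBracket_swap (P Q f g : MvPolynomial (Fin 4) k) :
    jacBracket P Q g f = -jacBracket P Q f g := by
  simp only [jacBracket_eq]; ring

theorem jacBracket_swap_casimirs (P Q f g : MvPolynomial (Fin 4) k) :
    jacBracket Q P f g = -jacBracket P Q f g := by
  simp only [jacBracket_eq]; ring

theorem jacBracket_self (P f g : MvPolynomial (Fin 4) k) : jacBracket P P f g = 0 := by
  simp only [jacBracket_eq]; ring

theorem jacBracket_add_right (P Q f g g' : MvPolynomial (Fin 4) k) :
    jacBracket P Q f (g + g') = jacBracket P Q f g + jacBracket P Q f g' := by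
  simp only [jacBracket_eq, map_add]; ring

theorem jacBracket_smul_right (c : k) (P Q f g : MvPolynomial (Fin 4) k) :
    jacBracket P Q f (c • g) = c • jacBracket P Q f g := by
  simp only [jacBracket_eq, smul_eq_C_mul, pderiv_C_mul]; ring

theorem jacBracket_mul_right (P Q f g g' : MvPolynomial (Fin 4) k) :
    jacBracket P Q f (g * g') = g * jacBracket P Q f g' + g' * jacBracket P Q f g := by
  simp only [jacBracket_eq, pderiv_mul]; ring

theorem jacBracket_add_left (P Q f f' g : MvPolynomial (Fin 4) k) :
    jacBracket P Q (f + f') g = jacBracket P Q f g + jacBracket P Q f' g := by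
  simp only [jacBracket_eq, map_add]; ring

theorem jacBracket_smul_left (c : k) (P Q f g : MvPolynomial (Fin 4) k) :
    jacBracket P Q (c • f) g = c • jacBracket P Q f g := by
  simp only [jacBracket_eq, smul_eq_C_mul, pderiv_C_mul]; ring

theorem jacBracket_neg_left (P Q f g : MvPolynomial (Fin 4) k) :
    jacBracket P Q (-f) g = -jacBracket P Q f g := by
  simp only [jacBracket_eq, map_neg]; ring

theorem jacBracket_add_casimir_left (P P' Q f g : MvPolynomial (Fin 4) k) :
    jacBracket (P + P') Q f g = jacBracket P Q f g + jacBracket P' Q f g := by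
  simp only [jacBracket_eq, map_add]; ring

theorem jacBracket_add_casimir_right (P Q Q' f g : MvPolynomial (Fin 4) k) :
    jacBracket P (Q + Q') f g = jacBracket P Q f g + jacBracket P Q' f g := by
  simp only [jacBracket_eq, map_add]; ring

theorem jacBracket_smul_casimir_left (c : k) (P Q f g : MvPolynomial (Fin 4) k) :
    jacBracket (c • P) Q f g = c • jacBracket P Q f g := by
  simp only [jacBracket_eq, smul_eq_C_mul, pderiv_C_mul]; ring

theorem jacBracket_smul_casimir_right (c : k) (P Q f g : MvPolynomial (Fin 4) k) :
    jacBracket P (c • Q) f g = c • jacBracket P Q f g := by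
  simp only [jacBracket_eq, smul_eq_C_mul, pderiv_C_mul]; ring

/-- The Hamiltonian derivation `{f, ·}` of the Jacobian bracket. -/
def jacHam (P Q f : MvPolynomial (Fin 4) k) :
    Derivation k (MvPolynomial (Fin 4) k) (MvPolynomial (Fin 4) k) :=
  Derivation.mk'
    { toFun := jacBracket P Q f
      map_add' := jacBracket_add_right P Q f
      map_smul' := fun c g => jacBracket_smul_right c P Q f g }
    (jacBracket_mul_right P Q f)

theorem jacHam_apply (P Q f g : MvPolynomial (Fin 4) k) :
    jacHam P Q f g = jacBracket P Q f g := rfl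

/-- The Jacobiator of a Jacobian bracket. -/
def jacobiator (P Q f g h : MvPolynomial (Fin 4) k) : MvPolynomial (Fin 4) k :=
  jacBracket P Q (jacBracket P Q f g) h + jacBracket P Q (jacBracket P Q g h) f +
    jacBracket P Q (jacBracket P Q h f) g

theorem jacobiator_rotate (P Q f g h : MvPolynomial (Fin 4) k) :
    jacobiator P Q g h f = jacobiator P Q f g h := by
  unfold jacobiator; ring

/-- The Jacobiator is a derivation in its last argument. -/
theorem jacobiator_eq_derivation (P Q f g h : MvPolynomial (Fin 4) k) :
    jacobiator P Q f g h =
      (jacHam P Q (jacBracket P Q f g) - ⁅jacHam P Q f, jacHam P Q g⁆) h := by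
  rw [Derivation.sub_apply, Derivation.commutator_apply]
  simp only [jacHam_apply, jacobiator]
  rw [jacBracket_swap P Q f (jacBracket P Q g h), jacBracket_swap P Q f h, jacBracket_neg_left,
    jacBracket_swap P Q g (jacBracket P Q f h)]
  ring

theorem jacobiator_eq_zero_of_X {P Q f g : MvPolynomial (Fin 4) k}
    (H : ∀ i, jacobiator P Q f g (X i) = 0) (h : MvPolynomial (Fin 4) k) :
    jacobiator P Q f g h = 0 := by
  rw [jacobiator_eq_derivation, derivation_eq_zero_of_forall_mem_vars fun i _ =>
    (jacobiator_eq_derivation P Q f g (X i)).symm.trans (H i)]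

theorem jacBracket_X_0 (P Q f : MvPolynomial (Fin 4) k) :
    jacBracket P Q f (X 0) =
      -pderiv 1 f * (pderiv 2 P * pderiv 3 Q - pderiv 3 P * pderiv 2 Q) +
        pderiv 2 f * (pderiv 1 P * pderiv 3 Q - pderiv 3 P * pderiv 1 Q) -
        pderiv 3 f * (pderiv 1 P * pderiv 2 Q - pderiv 2 P * pderiv 1 Q) := by
  have h (m : Fin 4) (hm : 0 ≠ m) : pderiv (R := k) m (X 0) = 0 := pderiv_X_of_ne hm
  rw [jacBracket_eq, pderiv_X_self, h 1 (by decide), h 2 (by decide), h 3 (by decide)]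
  ring

theorem jacBracket_X_1 (P Q f : MvPolynomial (Fin 4) k) :
    jacBracket P Q f (X 1) =
      pderiv 0 f * (pderiv 2 P * pderiv 3 Q - pderiv 3 P * pderiv 2 Q) -
        pderiv 2 f * (pderiv 0 P * pderiv 3 Q - pderiv 3 P * pderiv 0 Q) +
        pderiv 3 f * (pderiv 0 P * pderiv 2 Q - pderiv 2 P * pderiv 0 Q) := by
  have h (m : Fin 4) (hm : 1 ≠ m) : pderiv (R := k) m (X 1) = 0 := pderiv_X_of_ne hm
  rw [jacBracket_eq, pderiv_X_self, h 0 (by decide), h 2 (by decide), h 3 (by decide)]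
  ring

theorem jacBracket_X_2 (P Q f : MvPolynomial (Fin 4) k) :
    jacBracket P Q f (X 2) =
      -pderiv 0 f * (pderiv 1 P * pderiv 3 Q - pderiv 3 P * pderiv 1 Q) +
        pderiv 1 f * (pderiv 0 P * pderiv 3 Q - pderiv 3 P * pderiv 0 Q) -
        pderiv 3 f * (pderiv 0 P * pderiv 1 Q - pderiv 1 P * pderiv 0 Q) := by
  have h (m : Fin 4) (hm : 2 ≠ m) : pderiv (R := k) m (X 2) = 0 := pderiv_X_of_ne hm
  rw [jacBracket_eq, pderiv_X_self, h 0 (by decide), h 1 (by decide), h 3 (by decide)]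
  ring

theorem jacBracket_X_3 (P Q f : MvPolynomial (Fin 4) k) :
    jacBracket P Q f (X 3) =
      pderiv 0 f * (pderiv 1 P * pderiv 2 Q - pderiv 2 P * pderiv 1 Q) -
        pderiv 1 f * (pderiv 0 P * pderiv 2 Q - pderiv 2 P * pderiv 0 Q) +
        pderiv 2 f * (pderiv 0 P * pderiv 1 Q - pderiv 1 P * pderiv 0 Q) := by
  have h (m : Fin 4) (hm : 3 ≠ m) : pderiv (R := k) m (X 3) = 0 := pderiv_X_of_ne hm
  rw [jacBracket_eq, pderiv_X_self, h 0 (by decide), h 1 (by decide), h 2 (by decide)]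
  ring

set_option maxHeartbeats 2000000 in
/-- Jacobi identity on coordinate functions. -/
theorem jacobiator_X (P Q : MvPolynomial (Fin 4) k) (i j l : Fin 4) :
    jacobiator P Q (X i) (X j) (X l) = 0 := by
  have hc (a b : Fin 4) (f : MvPolynomial (Fin 4) k) := pderiv_pderiv_comm a b f
  have h1 (a : Fin 4) : pderiv (R := k) a (X a) = 1 := pderiv_X_self a
  have h0 (a b : Fin 4) (h : b ≠ a) : pderiv (R := k) a (X b) = 0 := pderiv_X_of_ne h
  fin_cases i <;> fin_cases j <;> fin_cases l <;>
  · simp only [Fin.reduceFinMk, Fin.zero_eta, Fin.mk_one, jacobiator, jacBracket_X_0,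
      jacBracket_X_1, jacBracket_X_2, jacBracket_X_3, h1, h0, ne_eq, Fin.reduceEq,
      not_false_eq_true, zero_ne_one, one_ne_zero, map_sub, map_neg, map_zero, pderiv_one,
      zero_mul, one_mul, neg_zero, add_zero, zero_add, sub_zero, zero_sub, pderiv_mul,
      hc 1 0, hc 2 0, hc 3 0, hc 2 1, hc 3 1, hc 3 2]
    try ring

theorem jacobiator_eq_zero (P Q f g h : MvPolynomial (Fin 4) k) : jacobiator P Q f g h = 0 := by
  refine jacobiator_eq_zero_of_X (fun l => ?_) h
  rw [← jacobiator_rotate, ← jacobiator_rotate]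
  refine jacobiator_eq_zero_of_X (fun j => ?_) g
  rw [← jacobiator_rotate, ← jacobiator_rotate]
  exact jacobiator_eq_zero_of_X (fun i => jacobiator_X P Q j l i) f

/-- Two Jacobian brackets sharing a Casimir are compatible. -/
theorem mixedJacobiator_shared_casimir (P Q S f g h : MvPolynomial (Fin 4) k) :
    mixedJacobiator (jacBracket P Q) (jacBracket P S) f g h = 0 := by
  have hQS := jacobiator_eq_zero P (Q + S) f g h
  have hQ := jacobiator_eq_zero P Q f g h
  have hS := jacobiator_eq_zero P S f g h
  simp only [jacobiator, jacBracket_add_casimir_right, jacBracket_add_left] at hQS hQ hS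
  unfold mixedJacobiator
  linear_combination hQS - hQ - hS

theorem mixedJacobiator_swap_casimirs_left (P Q R S f g h : MvPolynomial (Fin 4) k) :
    mixedJacobiator (jacBracket Q P) (jacBracket R S) f g h =
      -mixedJacobiator (jacBracket P Q) (jacBracket R S) f g h := by
  simp only [mixedJacobiator, jacBracket_swap_casimirs P Q, jacBracket_neg_left]; ring

theorem mixedJacobiator_swap_casimirs_right (P Q R S f g h : MvPolynomial (Fin 4) k) :
    mixedJacobiator (jacBracket P Q) (jacBracket S R) f g h =
      -mixedJacobiator (jacBracket P Q) (jacBracket R S) f g h := by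
  simp only [mixedJacobiator, jacBracket_swap_casimirs R S, jacBracket_neg_left]; ring

theorem mixedJacobiator_comm (b₁ b₂ : MvPolynomial (Fin 4) k → MvPolynomial (Fin 4) k →
    MvPolynomial (Fin 4) k) (f g h : MvPolynomial (Fin 4) k) :
    mixedJacobiator b₁ b₂ f g h = mixedJacobiator b₂ b₁ f g h := by
  unfold mixedJacobiator; ring

theorem mixedJacobiator_self_left (P R S f g h : MvPolynomial (Fin 4) k) :
    mixedJacobiator (jacBracket P P) (jacBracket R S) f g h = 0 := by
  have h0 (u : MvPolynomial (Fin 4) k) : jacBracket R S 0 u = 0 := by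
    simp [jacBracket_eq]
  simp only [mixedJacobiator, jacBracket_self, h0, add_zero]

/-- The mixed Jacobiator of two Jacobian brackets as an alternating function of the four
Casimirs. -/
def mixedJacobiatorAlternating (f g h : MvPolynomial (Fin 4) k) :
    MvPolynomial (Fin 4) k [⋀^Fin 4]→ₗ[k] MvPolynomial (Fin 4) k where
  toFun v := mixedJacobiator (jacBracket (v 0) (v 1)) (jacBracket (v 2) (v 3)) f g h
  map_update_add' v i x y := by
    rename_i inst
    obtain rfl : inst = instDecidableEqFin 4 := Subsingleton.elim _ _
    fin_cases i <;>
    · simp [mixedJacobiator, jacBracket_add_casimir_left,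
        jacBracket_add_casimir_right, jacBracket_add_left]
      ring
  map_update_smul' v i c x := by
    rename_i inst
    obtain rfl : inst = instDecidableEqFin 4 := Subsingleton.elim _ _
    fin_cases i <;>
    simp [mixedJacobiator, jacBracket_smul_casimir_left,
        jacBracket_smul_casimir_right, jacBracket_smul_left]
  map_eq_zero_of_eq' v i j hij hne := by
    wlog hlt : i < j generalizing i j
    · exact this j i hij.symm hne.symm (lt_of_le_of_ne (not_lt.mp hlt) hne.symm)
    fin_cases i <;> fin_cases j <;> first | exact absurd hlt (by decide) | dsimp at hij ⊢
    · rw [hij, mixedJacobiator_self_left]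
    · rw [hij, mixedJacobiator_shared_casimir]
    · rw [hij, mixedJacobiator_swap_casimirs_right, mixedJacobiator_shared_casimir, neg_zero]
    · rw [hij, mixedJacobiator_swap_casimirs_left, mixedJacobiator_shared_casimir, neg_zero]
    · rw [hij, mixedJacobiator_swap_casimirs_left, mixedJacobiator_swap_casimirs_right,
        mixedJacobiator_shared_casimir, neg_zero, neg_zero]
    · rw [hij, mixedJacobiator_comm, mixedJacobiator_self_left]

theorem mixedJacobiatorAlternating_apply (f g h P Q R S : MvPolynomial (Fin 4) k) :
    mixedJacobiatorAlternating f g h ![P, Q, R, S] =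
      mixedJacobiator (jacBracket P Q) (jacBracket R S) f g h := rfl

end Bracket

/-- If the homogeneous quadratic forms `Q₁, Q₂, Q₃, Q₄` are linearly dependent, then
the Jacobian brackets `{·,·}_{Q₁,Q₂}` and `{·,·}_{Q₃,Q₄}` are compatible: their mixed
Jacobiator vanishes identically. -/
theorem linearDependent_implies_compatible {k : Type*} [Field k] [CharZero k]
    (Q₁ Q₂ Q₃ Q₄ : MvPolynomial (Fin 4) k)
    (h₁ : Q₁.IsHomogeneous 2) (h₂ : Q₂.IsHomogeneous 2)
    (h₃ : Q₃.IsHomogeneous 2) (h₄ : Q₄.IsHomogeneous 2)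
    (hdep : ¬ LinearIndependent k ![Q₁, Q₂, Q₃, Q₄]) :
    ∀ f g h : MvPolynomial (Fin 4) k,
      mixedJacobiator (jacBracket Q₁ Q₂) (jacBracket Q₃ Q₄) f g h = 0 := by
  intro f g h
  rw [← mixedJacobiatorAlternating_apply]
  exact (mixedJacobiatorAlternating f g h).map_linearDependent _ hdep
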